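/- Product rule for packing pressure: Let (X,T) and (Y,R) be NDSs, Z ⊂ X_0, W ⊂ Y_0, and let f (on X) and g (on Y) be equicontinuous potentials. Then P^B(T,f,Z) + P^P(R,g,W) ≤ P^P(T×R, f∔g, Z×W) ≤ P^P(T,f,Z) + P^P(R,g,W), provided the sums appearing are not of the form (+∞)+(−∞). -/

import Mathlib

open Filter Set
open scoped ENNReal NNReal

noncomputable section

namespace NDS

variable {X : ℕ → Type*}

/-- The orbit maps `T_k^j : X k → X (k+j)` of a nonautonomous system. -/
def iterFrom (T : ∀ k, X k → X (k + 1)) (k : ℕ) : ∀ j, X k → X (k + j)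
  | 0 => fun x => x
  | j + 1 => fun x => T (k + j) (iterFrom T k j x)

/-- The orbit maps `T^j = T_{j-1} ∘ ⋯ ∘ T_0 : X 0 → X j`. -/
def iter (T : ∀ k, X k → X (k + 1)) : ∀ j, X 0 → X j
  | 0 => fun x => x
  | j + 1 => fun x => T j (iter T j x)

variable [∀ k, MetricSpace (X k)]

/-- The `n`-th Bowen metric on `X 0`:  `d_n^T(x,y) = max_{0 ≤ j ≤ n-1} d_j (T^j x) (T^j y)`. -/
def bowenDist (T : ∀ k, X k → X (k + 1)) (n : ℕ) (x y : X 0) : ℝ :=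
  (((Finset.range n).sup fun j => nndist (iter T j x) (iter T j y) : ℝ≥0) : ℝ)

/-- The open Bowen ball `B_n^T(x, ε)`. -/
def bowenBall (T : ∀ k, X k → X (k + 1)) (n : ℕ) (x : X 0) (ε : ℝ) : Set (X 0) :=
  {y | bowenDist T n x y < ε}

/-- The closed Bowen ball `clB_n^T(x, ε)`. -/
def bowenClosedBall (T : ∀ k, X k → X (k + 1)) (n : ℕ) (x : X 0) (ε : ℝ) : Set (X 0) :=
  {y | bowenDist T n x y ≤ ε}

/-- Birkhoff sums starting at level `k`:  `S_{k,n}^T f = Σ_{j<n} f_{k+j} ∘ T_k^j`. -/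
def birkFrom (T : ∀ k, X k → X (k + 1)) (f : ∀ k, X k → ℝ) (k n : ℕ) (x : X k) : ℝ :=
  ∑ j ∈ Finset.range n, f (k + j) (iterFrom T k j x)

/-- Birkhoff sums `S_n^T f = Σ_{j<n} f_j ∘ T^j` on `X 0`. -/
def birk (T : ∀ k, X k → X (k + 1)) (f : ∀ k, X k → ℝ) (n : ℕ) (x : X 0) : ℝ :=
  ∑ j ∈ Finset.range n, f j (iter T j x)

/-- A potential `f = {f_k}` is equicontinuous. -/
def EquicontPotential (f : ∀ k, X k → ℝ) : Prop :=
  ∀ ε : ℝ, 0 < ε → ∃ δ : ℝ, 0 < δ ∧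
    ∀ k, ∀ x y : X k, dist x y < δ → |f k x - f k y| < ε

/-- The sequence of maps `T = {T_k}` is equicontinuous. -/
def EquicontMaps (T : ∀ k, X k → X (k + 1)) : Prop :=
  ∀ ε : ℝ, 0 < ε → ∃ δ : ℝ, 0 < δ ∧
    ∀ k, ∀ x y : X k, dist x y < δ → dist (T k x) (T k y) < ε

/-- `F` is an `(n,ε)`-spanning set for `Z`. -/
def IsSpanning (T : ∀ k, X k → X (k + 1)) (n : ℕ) (ε : ℝ) (Z : Set (X 0))
    (F : Finset (X 0)) : Prop :=
  ∀ x ∈ Z, ∃ y ∈ F, bowenDist T n x y ≤ ε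

/-- `E` is an `(n,ε)`-separated set for `Z`. -/
def IsSeparated (T : ∀ k, X k → X (k + 1)) (n : ℕ) (ε : ℝ) (Z : Set (X 0))
    (E : Finset (X 0)) : Prop :=
  ↑E ⊆ Z ∧ ∀ x ∈ E, ∀ y ∈ E, x ≠ y → ε < bowenDist T n x y

/-- The partition sum `Σ_{x ∈ F} e^{S_n^T f(x)}` (valued in `ℝ≥0∞`). -/
def partSum (T : ∀ k, X k → X (k + 1)) (f : ∀ k, X k → ℝ) (n : ℕ) (F : Finset (X 0)) : ℝ≥0∞ :=
  ∑ x ∈ F, ENNReal.ofReal (Real.exp (birk T f n x))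

/-- `Q_n(T,f,Z,ε)`, infimum over `(n,ε)`-spanning sets. -/
def Qn (T : ∀ k, X k → X (k + 1)) (f : ∀ k, X k → ℝ) (Z : Set (X 0)) (n : ℕ) (ε : ℝ) : ℝ≥0∞ :=
  ⨅ (F : Finset (X 0)) (_ : IsSpanning T n ε Z F), partSum T f n F

/-- `P_n(T,f,Z,ε)`, supremum over `(n,ε)`-separated sets. -/
def Pn (T : ∀ k, X k → X (k + 1)) (f : ∀ k, X k → ℝ) (Z : Set (X 0)) (n : ℕ) (ε : ℝ) : ℝ≥0∞ :=
  ⨆ (E : Finset (X 0)) (_ : IsSeparated T n ε Z E), partSum T f n E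

/-- `liminf_n (1/n) log u n` (in `EReal`). -/
def lowRate (u : ℕ → ℝ≥0∞) : EReal :=
  Filter.atTop.liminf fun n : ℕ => (((n : ℝ)⁻¹ : ℝ) : EReal) * ENNReal.log (u n)

/-- `limsup_n (1/n) log u n` (in `EReal`). -/
def upRate (u : ℕ → ℝ≥0∞) : EReal :=
  Filter.atTop.limsup fun n : ℕ => (((n : ℝ)⁻¹ : ℝ) : EReal) * ENNReal.log (u n)

/-- Lower spanning topological pressure `Q_low(T,f,Z)`; the limit as `ε → 0` is realised as a
supremum over `ε > 0`, the quantity being monotone in `ε`. -/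
def Qlow (T : ∀ k, X k → X (k + 1)) (f : ∀ k, X k → ℝ) (Z : Set (X 0)) : EReal :=
  ⨆ (ε : ℝ) (_ : 0 < ε), lowRate fun n => Qn T f Z n ε

/-- Upper spanning topological pressure `Q_up(T,f,Z)`. -/
def Qup (T : ∀ k, X k → X (k + 1)) (f : ∀ k, X k → ℝ) (Z : Set (X 0)) : EReal :=
  ⨆ (ε : ℝ) (_ : 0 < ε), upRate fun n => Qn T f Z n ε

/-- Lower separated topological pressure `P_low(T,f,Z)`. -/
def Plow (T : ∀ k, X k → X (k + 1)) (f : ∀ k, X k → ℝ) (Z : Set (X 0)) : EReal :=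
  ⨆ (ε : ℝ) (_ : 0 < ε), lowRate fun n => Pn T f Z n ε

/-- Upper separated topological pressure `P_up(T,f,Z)`. -/
def Pup (T : ∀ k, X k → X (k + 1)) (f : ∀ k, X k → ℝ) (Z : Set (X 0)) : EReal :=
  ⨆ (ε : ℝ) (_ : 0 < ε), upRate fun n => Pn T f Z n ε

/-- The critical value `inf {s : M s = 0}` of a "measure profile" `M`, as an extended real. -/
def crit (M : ℝ → ℝ≥0∞) : EReal :=
  sInf (Real.toEReal '' {s : ℝ | M s = 0})

/-- The critical value `sup {s : M s = ∞}` of a "measure profile" `M`, as an extended real. -/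
def critSup (M : ℝ → ℝ≥0∞) : EReal :=
  sSup (Real.toEReal '' {s : ℝ | M s = ⊤})

/-- A countable family of Bowen balls (recorded by their (center, order) data) which is an
`(N,ε)`-cover of `Z`. -/
def IsBowenCover (T : ∀ k, X k → X (k + 1)) (N : ℕ) (ε : ℝ) (Z : Set (X 0))
    (C : Set (X 0 × ℕ)) : Prop :=
  C.Countable ∧ (∀ p ∈ C, N ≤ p.2) ∧ Z ⊆ ⋃ p ∈ C, bowenBall T p.2 p.1 ε

/-- A countable disjoint family of closed Bowen balls with centers in `Z` and orders `≥ N`: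
an `(N,ε)`-packing of `Z`. -/
def IsBowenPacking (T : ∀ k, X k → X (k + 1)) (N : ℕ) (ε : ℝ) (Z : Set (X 0))
    (P : Set (X 0 × ℕ)) : Prop :=
  P.Countable ∧ (∀ p ∈ P, p.1 ∈ Z ∧ N ≤ p.2) ∧
    ∀ p ∈ P, ∀ q ∈ P, p ≠ q →
      Disjoint (bowenClosedBall T p.2 p.1 ε) (bowenClosedBall T q.2 q.1 ε)

/-- `Σ_i exp (-n_i s + S_{n_i}^T f (x_i))` over a family of (center, order) pairs. -/
def ballSum (T : ∀ k, X k → X (k + 1)) (f : ∀ k, X k → ℝ) (s : ℝ) (C : Set (X 0 × ℕ)) : ℝ≥0∞ :=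
  ∑' p : C, ENNReal.ofReal (Real.exp (-(p.1.2 : ℝ) * s + birk T f p.1.2 p.1.1))

/-- The Hausdorff-type pre-measure `M^s_{N,ε}(T,f,Z)`. -/
def bowenPreMeas (T : ∀ k, X k → X (k + 1)) (f : ∀ k, X k → ℝ) (Z : Set (X 0))
    (s : ℝ) (N : ℕ) (ε : ℝ) : ℝ≥0∞ :=
  ⨅ (C : Set (X 0 × ℕ)) (_ : IsBowenCover T N ε Z C), ballSum T f s C

/-- `M^s_ε(T,f,Z) = lim_{N → ∞} M^s_{N,ε}(T,f,Z)` (an increasing limit, i.e. a supremum). -/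
def bowenMeas (T : ∀ k, X k → X (k + 1)) (f : ∀ k, X k → ℝ) (Z : Set (X 0))
    (s : ℝ) (ε : ℝ) : ℝ≥0∞ :=
  ⨆ N : ℕ, bowenPreMeas T f Z s N ε

/-- `P^B(T,f,Z,ε)`: the critical value of `s ↦ M^s_ε(T,f,Z)`. -/
def PBe (T : ∀ k, X k → X (k + 1)) (f : ∀ k, X k → ℝ) (Z : Set (X 0)) (ε : ℝ) : EReal :=
  crit fun s => bowenMeas T f Z s ε

/-- The Bowen (Pesin–Pitskel') topological pressure `P^B(T,f,Z)`; the limit as `ε → 0` is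
realised as a supremum over `ε > 0` by monotonicity. -/
def PB (T : ∀ k, X k → X (k + 1)) (f : ∀ k, X k → ℝ) (Z : Set (X 0)) : EReal :=
  ⨆ (ε : ℝ) (_ : 0 < ε), PBe T f Z ε

/-- The packing pre-measure `𝒫^s_{N,ε}(T,f,Z)`. -/
def packPre (T : ∀ k, X k → X (k + 1)) (f : ∀ k, X k → ℝ) (Z : Set (X 0))
    (s : ℝ) (N : ℕ) (ε : ℝ) : ℝ≥0∞ :=
  ⨆ (P : Set (X 0 × ℕ)) (_ : IsBowenPacking T N ε Z P), ballSum T f s P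

/-- The packing content `𝒫^s_{∞,ε}(T,f,Z) = lim_{N→∞} 𝒫^s_{N,ε}` (a decreasing limit, i.e. an
infimum). -/
def packContent (T : ∀ k, X k → X (k + 1)) (f : ∀ k, X k → ℝ) (Z : Set (X 0))
    (s : ℝ) (ε : ℝ) : ℝ≥0∞ :=
  ⨅ N : ℕ, packPre T f Z s N ε

/-- The packing measure `𝒫^s_ε(T,f,Z)`, obtained from the content by countable decompositions. -/
def packMeas (T : ∀ k, X k → X (k + 1)) (f : ∀ k, X k → ℝ) (Z : Set (X 0))
    (s : ℝ) (ε : ℝ) : ℝ≥0∞ :=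
  ⨅ (D : ℕ → Set (X 0)) (_ : Z ⊆ ⋃ i, D i), ∑' i, packContent T f (D i) s ε

/-- `P^P(T,f,Z,ε)`: the critical value of `s ↦ 𝒫^s_ε(T,f,Z)`. -/
def PPe (T : ∀ k, X k → X (k + 1)) (f : ∀ k, X k → ℝ) (Z : Set (X 0)) (ε : ℝ) : EReal :=
  crit fun s => packMeas T f Z s ε

/-- The packing topological pressure `P^P(T,f,Z)`. -/
def PP (T : ∀ k, X k → X (k + 1)) (f : ∀ k, X k → ℝ) (Z : Set (X 0)) : EReal :=
  ⨆ (ε : ℝ) (_ : 0 < ε), PPe T f Z ε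

end NDS

/-- The sum `a + b` in `EReal` is not of the indeterminate form `(+∞) + (−∞)`. -/
def NDS.AddCompat (a b : EReal) : Prop :=
  ¬(a = ⊤ ∧ b = ⊥) ∧ ¬(a = ⊥ ∧ b = ⊤)

namespace NDS

section aux

variable {X Y : ℕ → Type*} [∀ k, MetricSpace (X k)] [∀ k, MetricSpace (Y k)]

theorem bd_lt_iff (T : ∀ k, X k → X (k + 1)) (n : ℕ) (x y : X 0) {ε : ℝ} (hε : 0 < ε) :
    bowenDist T n x y < ε ↔ ∀ j < n, dist (iter T j x) (iter T j y) < ε := by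
  lift ε to ℝ≥0 using hε.le
  have h0 : (⊥ : ℝ≥0) < ε := by exact_mod_cast hε
  unfold bowenDist
  rw [NNReal.coe_lt_coe, Finset.sup_lt_iff h0]
  simp only [Finset.mem_range, ← NNReal.coe_lt_coe, coe_nndist]

theorem bd_le_iff (T : ∀ k, X k → X (k + 1)) (n : ℕ) (x y : X 0) {ε : ℝ} (hε : 0 ≤ ε) :
    bowenDist T n x y ≤ ε ↔ ∀ j < n, dist (iter T j x) (iter T j y) ≤ ε := by
  lift ε to ℝ≥0 using hε
  unfold bowenDist
  rw [NNReal.coe_le_coe, Finset.sup_le_iff]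
  simp only [Finset.mem_range, ← NNReal.coe_le_coe, coe_nndist]

theorem bd_nonneg (T : ∀ k, X k → X (k + 1)) (n : ℕ) (x y : X 0) : 0 ≤ bowenDist T n x y :=
  NNReal.coe_nonneg _

theorem bd_comm (T : ∀ k, X k → X (k + 1)) (n : ℕ) (x y : X 0) :
    bowenDist T n x y = bowenDist T n y x := by
  unfold bowenDist
  simp only [nndist_comm]

theorem bd_self (T : ∀ k, X k → X (k + 1)) (n : ℕ) (x : X 0) : bowenDist T n x x = 0 := by
  refine le_antisymm ((bd_le_iff T n x x le_rfl).2 ?_) (bd_nonneg _ _ _ _)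
  simp

theorem bd_triangle (T : ∀ k, X k → X (k + 1)) (n : ℕ) (x y z : X 0) :
    bowenDist T n x z ≤ bowenDist T n x y + bowenDist T n y z := by
  rw [bd_le_iff T n x z (add_nonneg (bd_nonneg _ _ _ _) (bd_nonneg _ _ _ _))]
  intro j hj
  have h1 := (bd_le_iff T n x y (bd_nonneg T n x y)).1 le_rfl j hj
  have h2 := (bd_le_iff T n y z (bd_nonneg T n y z)).1 le_rfl j hj
  linarith [dist_triangle (iter T j x) (iter T j y) (iter T j z)]

theorem continuous_iter (T : ∀ k, X k → X (k + 1)) (hT : ∀ k, Continuous (T k)) :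
    ∀ j, Continuous (iter T j)
  | 0 => continuous_id
  | j + 1 => (hT j).comp (continuous_iter T hT j)

theorem isOpen_bowenBall (T : ∀ k, X k → X (k + 1)) (hT : ∀ k, Continuous (T k)) (n : ℕ)
    (x : X 0) {ε : ℝ} (hε : 0 < ε) : IsOpen (bowenBall T n x ε) := by
  have : bowenBall T n x ε = ⋂ j ∈ Finset.range n, {y | dist (iter T j x) (iter T j y) < ε} := by
    ext y
    simp [bowenBall, bd_lt_iff T n x y hε]
  rw [this]
  refine isOpen_biInter_finset fun j _ => ?_
  exact isOpen_lt (continuous_const.dist (continuous_iter T hT j)) continuous_const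

/-- A countable maximal separated set. -/
theorem exists_maxsep [CompactSpace (X 0)] (T : ∀ k, X k → X (k + 1))
    (hT : ∀ k, Continuous (T k)) (n : ℕ) {ε : ℝ} (hε : 0 < ε) (D : Set (X 0)) :
    ∃ E : Set (X 0), E ⊆ D ∧ E.Countable ∧
      (∀ x ∈ E, ∀ y ∈ E, x ≠ y → ε ≤ bowenDist T n x y) ∧
      ∀ x ∈ D, ∃ y ∈ E, bowenDist T n y x < ε := by
  let S : Set (Set (X 0)) :=
    {E | E ⊆ D ∧ ∀ x ∈ E, ∀ y ∈ E, x ≠ y → ε ≤ bowenDist T n x y}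
  obtain ⟨E, hE⟩ : ∃ E, Maximal (· ∈ S) E := by
    refine zorn_subset S fun c hc hchain => ⟨⋃₀ c, ⟨?_, ?_⟩, fun s hs => subset_sUnion_of_mem hs⟩
    · exact sUnion_subset fun s hs => (hc hs).1
    · rintro x ⟨s, hs, hxs⟩ y ⟨t, ht, hyt⟩ hxy
      rcases hchain.total hs ht with h | h
      · exact (hc ht).2 x (h hxs) y hyt hxy
      · exact (hc hs).2 x hxs y (h hyt) hxy
  refine ⟨E, hE.prop.1, ?_, hE.prop.2, ?_⟩
  · refine Set.PairwiseDisjoint.countable_of_isOpen (s := fun x => bowenBall T n x (ε / 2)) ?_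
      (fun x _ => isOpen_bowenBall T hT n x (half_pos hε)) ?_
    · intro x hx y hy hxy
      refine Set.disjoint_left.2 fun z hz hz' => ?_
      have h1 : bowenDist T n x z < ε / 2 := hz
      have h2 : bowenDist T n y z < ε / 2 := hz'
      have h3 := hE.prop.2 x hx y hy hxy
      have h4 := bd_triangle T n x z y
      rw [bd_comm T n z y] at h4
      linarith
    · intro x _
      refine ⟨x, ?_⟩
      change bowenDist T n x x < ε / 2
      rw [bd_self]; linarith
  · intro x hx
    by_contra! hcon
    have hmem : insert x E ∈ S := by
      refine ⟨insert_subset hx hE.prop.1, ?_⟩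
      rintro a (rfl | ha) b (rfl | hb) hab
      · exact absurd rfl hab
      · rw [bd_comm]; exact hcon b hb
      · exact hcon a ha
      · exact hE.prop.2 a ha b hb hab
    have hxE : x ∈ E := hE.le_of_ge hmem (subset_insert _ _) (mem_insert _ _)
    have := hcon x hxE
    rw [bd_self] at this
    linarith

theorem packPre_anti (T : ∀ k, X k → X (k + 1)) (f : ∀ k, X k → ℝ) (Z : Set (X 0))
    (s : ℝ) (ε : ℝ) {N M : ℕ} (h : N ≤ M) : packPre T f Z s M ε ≤ packPre T f Z s N ε :=
  iSup₂_le fun P hP =>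
    le_iSup₂_of_le P ⟨hP.1, fun p hp => ⟨(hP.2.1 p hp).1, h.trans (hP.2.1 p hp).2⟩, hP.2.2⟩ le_rfl

theorem packPre_decay (T : ∀ k, X k → X (k + 1)) (f : ∀ k, X k → ℝ) (Z : Set (X 0))
    {r r' : ℝ} (hr : r < r') (ε : ℝ) (N : ℕ) :
    packPre T f Z r' N ε ≤ ENNReal.ofReal (Real.exp (-(r' - r)) ^ N) * packPre T f Z r N ε := by
  refine iSup₂_le fun P hP => ?_
  refine le_trans ?_ (mul_le_mul_right (le_iSup₂_of_le P hP le_rfl) _)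
  unfold ballSum
  rw [← ENNReal.tsum_mul_left]
  refine ENNReal.tsum_le_tsum fun p => ?_
  rw [← ENNReal.ofReal_mul (by positivity), ← Real.exp_nat_mul, ← Real.exp_add]
  refine ENNReal.ofReal_le_ofReal (Real.exp_le_exp.2 ?_)
  have : (N : ℝ) ≤ (p.1.2 : ℝ) := by exact_mod_cast (hP.2.1 p.1 p.2).2
  nlinarith

theorem packContent_zero (T : ∀ k, X k → X (k + 1)) (f : ∀ k, X k → ℝ) (Z : Set (X 0))
    {r r' : ℝ} (hr : r < r') (ε : ℝ) (h : packContent T f Z r ε ≠ ⊤) :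
    packContent T f Z r' ε = 0 := by
  obtain ⟨N, hN⟩ : ∃ N, packPre T f Z r N ε < ⊤ := by
    have := lt_top_iff_ne_top.2 h
    unfold packContent at this
    exact iInf_lt_iff.1 this
  have hlim : Tendsto (fun M : ℕ => ENNReal.ofReal (Real.exp (-(r' - r)) ^ M) *
      packPre T f Z r N ε) atTop (nhds 0) := by
    have h1 : Tendsto (fun M : ℕ => Real.exp (-(r' - r)) ^ M) atTop (nhds 0) :=
      tendsto_pow_atTop_nhds_zero_of_lt_one (Real.exp_pos _).le
        (by rw [Real.exp_lt_one_iff]; linarith)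
    have h2 := ENNReal.tendsto_ofReal h1
    have h3 := ENNReal.Tendsto.mul_const h2 (b := packPre T f Z r N ε) (Or.inr hN.ne)
    simpa using h3
  refine le_antisymm (ge_of_tendsto hlim ?_) bot_le
  filter_upwards [eventually_ge_atTop N] with M hM
  refine (iInf_le _ M).trans ((packPre_decay T f Z hr ε M).trans ?_)
  exact mul_le_mul_right (packPre_anti T f Z r ε hM) _

theorem bowenPre_zero_of_cover (T : ∀ k, X k → X (k + 1)) (f : ∀ k, X k → ℝ) (Z : Set (X 0))
    (D : ℕ → Set (X 0)) (hZ : Z ⊆ ⋃ i, D i) (s ε : ℝ) (N : ℕ)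
    (h : ∀ i, bowenPreMeas T f (D i) s N ε = 0) : bowenPreMeas T f Z s N ε = 0 := by
  refine le_antisymm (le_of_forall_gt_imp_ge_of_dense fun δ hδ => ?_) bot_le
  obtain ⟨δ', hδ', hsum⟩ := ENNReal.exists_pos_sum_of_countable hδ.ne' ℕ
  have hC : ∀ i, ∃ C, IsBowenCover T N ε (D i) C ∧ ballSum T f s C < δ' i := by
    intro i
    have : bowenPreMeas T f (D i) s N ε < δ' i := by
      rw [h i]; exact_mod_cast hδ' i
    simpa [bowenPreMeas, iInf_lt_iff] using this
  choose C hC1 hC2 using hC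
  have hcov : IsBowenCover T N ε Z (⋃ i, C i) := by
    refine ⟨countable_iUnion fun i => (hC1 i).1, ?_, ?_⟩
    · intro p hp
      obtain ⟨i, hi⟩ := mem_iUnion.1 hp
      exact (hC1 i).2.1 p hi
    · intro x hx
      obtain ⟨i, hi⟩ := mem_iUnion.1 (hZ hx)
      obtain ⟨p, hp, hxp⟩ := mem_iUnion₂.1 ((hC1 i).2.2 hi)
      exact mem_iUnion₂.2 ⟨p, mem_iUnion.2 ⟨i, hp⟩, hxp⟩
  refine (iInf₂_le (⋃ i, C i) hcov).trans ?_
  · refine le_trans ?_ hsum.le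
    refine le_trans ?_ (ENNReal.tsum_le_tsum fun i => (hC2 i).le)
    exact ENNReal.tsum_iUnion_le_tsum
      (fun p : X 0 × ℕ => ENNReal.ofReal (Real.exp (-(p.2 : ℝ) * s + birk T f p.2 p.1))) C

abbrev prodT (T : ∀ k, X k → X (k + 1)) (R : ∀ k, Y k → Y (k + 1)) :
    ∀ k, X k × Y k → X (k + 1) × Y (k + 1) := fun k p => (T k p.1, R k p.2)

abbrev prodF (f : ∀ k, X k → ℝ) (g : ∀ k, Y k → ℝ) : ∀ k, X k × Y k → ℝ :=
  fun k p => f k p.1 + g k p.2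

theorem iter_prod (T : ∀ k, X k → X (k + 1)) (R : ∀ k, Y k → Y (k + 1)) (p : X 0 × Y 0) :
    ∀ j, iter (X := fun k => X k × Y k) (prodT T R) j p = (iter T j p.1, iter R j p.2)
  | 0 => rfl
  | j + 1 => by simp only [iter, iter_prod T R p j]

theorem birk_prod (T : ∀ k, X k → X (k + 1)) (R : ∀ k, Y k → Y (k + 1))
    (f : ∀ k, X k → ℝ) (g : ∀ k, Y k → ℝ) (n : ℕ) (p : X 0 × Y 0) :
    birk (X := fun k => X k × Y k) (prodT T R) (prodF f g) n p
      = birk T f n p.1 + birk R g n p.2 := by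
  unfold birk
  rw [← Finset.sum_add_distrib]
  exact Finset.sum_congr rfl fun j _ => by rw [iter_prod]

theorem bd_prod_le (T : ∀ k, X k → X (k + 1)) (R : ∀ k, Y k → Y (k + 1)) (n : ℕ)
    (p q : X 0 × Y 0) {ε : ℝ} (hε : 0 ≤ ε) :
    bowenDist (X := fun k => X k × Y k) (prodT T R) n p q ≤ ε ↔
      bowenDist T n p.1 q.1 ≤ ε ∧ bowenDist R n p.2 q.2 ≤ ε := by
  rw [bd_le_iff (X := fun k => X k × Y k) _ _ _ _ hε, bd_le_iff _ _ _ _ hε,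
    bd_le_iff _ _ _ _ hε]
  simp only [iter_prod, Prod.dist_eq, sup_le_iff]
  exact ⟨fun h => ⟨fun j hj => (h j hj).1, fun j hj => (h j hj).2⟩,
    fun h j hj => ⟨h.1 j hj, h.2 j hj⟩⟩

theorem lower_pre [CompactSpace (X 0)] (T : ∀ k, X k → X (k + 1)) (hT : ∀ k, Continuous (T k))
    (R : ∀ k, Y k → Y (k + 1)) (f : ∀ k, X k → ℝ) (g : ∀ k, Y k → ℝ)
    (D : Set (X 0 × Y 0)) (W : Set (Y 0)) (s t : ℝ) {ε₁ ε₂ ε : ℝ} (h1 : 0 < ε₁)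
    (hε : 0 < ε) (hε1 : ε < ε₁ / 2) (hε2 : ε ≤ ε₂) (c : ℝ≥0∞) (N : ℕ)
    (hc : ∀ y ∈ W, c ≤ bowenPreMeas T f {x | (x, y) ∈ D} s N ε₁) (M : ℕ) (hM : N ≤ M) :
    packPre R g W t M ε₂ * c ≤
      packPre (X := fun k => X k × Y k) (prodT T R) (prodF f g) D (s + t) M ε := by
  unfold packPre
  simp only [ENNReal.iSup_mul]
  refine iSup₂_le fun P hP => ?_
  choose E hED hEc hEs hEm using fun p : Y 0 × ℕ =>
    exists_maxsep T hT p.2 h1 {x | (x, p.1) ∈ D}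
  let Q : Set ((X 0 × Y 0) × ℕ) := {q | (q.1.2, q.2) ∈ P ∧ q.1.1 ∈ E (q.1.2, q.2)}
  have hQc : Q.Countable := by
    refine (hP.1.biUnion fun p _ => (hEc p).image fun x => ((x, p.1), p.2)).mono ?_
    rintro ⟨⟨x, y⟩, n⟩ ⟨hq, hx⟩
    exact mem_iUnion₂.2 ⟨(y, n), hq, x, hx, rfl⟩
  have hQ : IsBowenPacking (X := fun k => X k × Y k) (prodT T R) M ε D Q := by
    refine ⟨hQc, ?_, ?_⟩
    · rintro ⟨⟨x, y⟩, n⟩ ⟨hq, hx⟩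
      exact ⟨hED (y, n) hx, (hP.2.1 _ hq).2⟩
    · rintro ⟨⟨x, y⟩, n⟩ ⟨hq, hx⟩ ⟨⟨x', y'⟩, n'⟩ ⟨hq', hx'⟩ hne
      dsimp only at hq hx hq' hx'
      refine Set.disjoint_left.2 ?_
      rintro ⟨a, b⟩ hz hz'
      obtain ⟨ha, hb⟩ := (bd_prod_le T R n (x, y) (a, b) hε.le).1 hz
      obtain ⟨ha', hb'⟩ := (bd_prod_le T R n' (x', y') (a, b) hε.le).1 hz'
      dsimp only at ha hb ha' hb'
      by_cases hyn : (y, n) = (y', n')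
      · obtain ⟨rfl, rfl⟩ := Prod.mk.inj hyn
        have hxx : x ≠ x' := by
          rintro rfl; exact hne rfl
        have h3 := hEs _ x hx x' hx' hxx
        have h4 := bd_triangle T n x a x'
        rw [bd_comm T n a x'] at h4
        dsimp only at h3
        linarith
      · exact Set.disjoint_left.1 (hP.2.2 _ hq _ hq' hyn) (hb.trans hε2) (hb'.trans hε2)
  refine le_trans ?_ (le_iSup₂_of_le Q hQ le_rfl)
  unfold ballSum
  rw [← ENNReal.tsum_mul_right]
  let φ : (Σ p : P, E p.1) → Q := fun z => ⟨((z.2.1, z.1.1.1), z.1.1.2), z.1.2, z.2.2⟩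
  have hφ : Function.Injective φ := by
    rintro ⟨⟨⟨y, n⟩, hp⟩, ⟨x, hx⟩⟩ ⟨⟨⟨y', n'⟩, hp'⟩, ⟨x', hx'⟩⟩ h
    have h' := congrArg Subtype.val h
    simp only [φ, Prod.mk.injEq] at h'
    obtain ⟨⟨rfl, rfl⟩, rfl⟩ := h'
    rfl
  refine le_trans ?_ (ENNReal.tsum_comp_le_tsum_of_injective hφ _)
  rw [ENNReal.tsum_sigma']
  refine ENNReal.tsum_le_tsum fun p => ?_
  obtain ⟨⟨y, n⟩, hp⟩ := p
  have hcov : IsBowenCover T N ε₁ {x | (x, y) ∈ D} ((fun x => (x, n)) '' E (y, n)) := by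
    refine ⟨(hEc _).image _, ?_, ?_⟩
    · rintro _ ⟨x, hx, rfl⟩
      exact hM.trans (hP.2.1 _ hp).2
    · intro x hx
      obtain ⟨e, he, hlt⟩ := hEm (y, n) x hx
      exact mem_iUnion₂.2 ⟨(e, n), ⟨e, he, rfl⟩, hlt⟩
  have hcE : c ≤ ∑' x : E (y, n), ENNReal.ofReal (Real.exp (-(n : ℝ) * s + birk T f n x)) := by
    refine (hc y (hP.2.1 _ hp).1).trans ((iInf₂_le _ hcov).trans ?_)
    unfold ballSum
    rw [tsum_image (fun p : X 0 × ℕ =>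
      ENNReal.ofReal (Real.exp (-(p.2 : ℝ) * s + birk T f p.2 p.1)))
      (fun a _ b _ h => (Prod.mk.inj h).1)]
  refine (mul_le_mul_right hcE _).trans ?_
  rw [← ENNReal.tsum_mul_left]
  refine ENNReal.tsum_le_tsum fun x => ?_
  rw [← ENNReal.ofReal_mul (Real.exp_pos _).le, ← Real.exp_add]
  refine ENNReal.ofReal_le_ofReal (Real.exp_le_exp.2 (le_of_eq ?_))
  simp only [φ]
  rw [birk_prod]
  ring

theorem lower_main [CompactSpace (X 0)] (T : ∀ k, X k → X (k + 1)) (hT : ∀ k, Continuous (T k))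
    (R : ∀ k, Y k → Y (k + 1)) (f : ∀ k, X k → ℝ) (g : ∀ k, Y k → ℝ)
    (Z : Set (X 0)) (W : Set (Y 0)) (s t r : ℝ) {ε₁ ε₂ ε : ℝ} (h1 : 0 < ε₁)
    (hε : 0 < ε) (hε1 : ε < ε₁ / 2) (hε2 : ε ≤ ε₂) (hs : bowenMeas T f Z s ε₁ ≠ 0)
    (ht : packMeas R g W t ε₂ ≠ 0) (hr : r < s + t) :
    packMeas (X := fun k => X k × Y k) (prodT T R) (prodF f g) (Z ×ˢ W) r ε ≠ 0 := by
  intro h0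
  obtain ⟨D, hD, hDs⟩ : ∃ D : ℕ → Set (X 0 × Y 0), Z ×ˢ W ⊆ ⋃ i, D i ∧
      ∑' i, packContent (X := fun k => X k × Y k) (prodT T R) (prodF f g) (D i) r ε < 1 := by
    have : packMeas (X := fun k => X k × Y k) (prodT T R) (prodF f g) (Z ×ˢ W) r ε < 1 := by
      rw [h0]; exact zero_lt_one
    simpa [packMeas, iInf_lt_iff] using this
  have hD0 : ∀ i, packContent (X := fun k => X k × Y k) (prodT T R) (prodF f g) (D i)
      (s + t) ε = 0 := fun i =>
    packContent_zero (X := fun k => X k × Y k) _ _ _ hr ε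
      ((ENNReal.le_tsum i).trans_lt (hDs.trans ENNReal.one_lt_top)).ne
  let V : ℕ × ℕ × ℕ → Set (Y 0) := fun z =>
    {y | ((z.2.2 : ℝ≥0∞) + 1)⁻¹ ≤ bowenPreMeas T f {x | (x, y) ∈ D z.1} s z.2.1 ε₁}
  have hV : ∀ z, packContent R g (V z) t ε₂ = 0 := by
    intro z
    have hle : packContent R g (V z) t ε₂ * ((z.2.2 : ℝ≥0∞) + 1)⁻¹ ≤ 0 := by
      rw [← hD0 z.1]
      refine le_iInf fun M => ?_
      refine (mul_le_mul_left (iInf_le _ (max z.2.1 M)) _).trans ?_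
      refine (lower_pre T hT R f g (D z.1) (V z) s t h1 hε hε1 hε2 _ z.2.1 (fun y hy => hy) _
        (le_max_left _ _)).trans ?_
      exact packPre_anti (X := fun k => X k × Y k) _ _ _ _ _ (le_max_right _ _)
    have h2 : ((z.2.2 : ℝ≥0∞) + 1)⁻¹ ≠ 0 := by
      rw [ENNReal.inv_ne_zero]
      exact ENNReal.add_ne_top.2 ⟨ENNReal.natCast_ne_top _, ENNReal.one_ne_top⟩
    exact (mul_eq_zero.1 (le_antisymm hle bot_le)).resolve_right h2
  apply ht
  obtain ⟨e⟩ : Nonempty (ℕ ≃ ℕ × ℕ × ℕ) := ⟨(Denumerable.eqv (ℕ × ℕ × ℕ)).symm⟩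
  refine le_antisymm ((iInf₂_le (fun i => V (e i)) ?_).trans (by simp [hV])) bot_le
  intro y hy
  by_contra hcon
  apply hs
  have hall : ∀ i N, bowenPreMeas T f {x | (x, y) ∈ D i} s N ε₁ = 0 := by
    intro i N
    by_contra hne
    obtain ⟨k, hk⟩ := ENNReal.exists_inv_nat_lt hne
    refine hcon (mem_iUnion.2 ⟨e.symm (i, N, k), ?_⟩)
    simp only [Equiv.apply_symm_apply, V, mem_setOf_eq]
    exact (ENNReal.inv_le_inv.2 le_self_add).trans hk.le
  refine le_antisymm (iSup_le fun N => ?_) bot_le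
  refine (bowenPre_zero_of_cover T f Z (fun i => {x | (x, y) ∈ D i}) ?_ s ε₁ N
    fun i => hall i N).le
  intro x hx
  obtain ⟨i, hi⟩ := mem_iUnion.1 (hD (⟨hx, hy⟩ : (x, y) ∈ Z ×ˢ W))
  exact mem_iUnion.2 ⟨i, hi⟩

theorem birk_close (T : ∀ k, X k → X (k + 1)) (f : ∀ k, X k → ℝ) {η δ : ℝ} (hδ : 0 < δ)
    (h : ∀ k, ∀ x y : X k, dist x y < δ → |f k x - f k y| < η) (n : ℕ) (x y : X 0)
    (hxy : bowenDist T n y x < δ) : birk T f n x ≤ birk T f n y + n * η := by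
  unfold birk
  have h2 := (bd_lt_iff T n y x hδ).1 hxy
  calc ∑ j ∈ Finset.range n, f j (iter T j x)
      ≤ ∑ j ∈ Finset.range n, (f j (iter T j y) + η) := by
        refine Finset.sum_le_sum fun j hj => ?_
        have := (abs_lt.1 (h j _ _ (h2 j (Finset.mem_range.1 hj)))).1
        linarith
    _ = _ := by rw [Finset.sum_add_distrib]; simp

/-- partition-sum bound for maximal separated sets -/
theorem exists_span [CompactSpace (X 0)] (T : ∀ k, X k → X (k + 1)) (hT : ∀ k, Continuous (T k))
    (f : ∀ k, X k → ℝ) (D : Set (X 0)) (s : ℝ) {ε : ℝ} (hε : 0 < ε)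
    (n N : ℕ) (hn : N ≤ n) (hN : packPre T f D s N (ε / 3) ≤ 1) :
    ∃ E : Set (X 0), (∀ x ∈ D, ∃ y ∈ E, bowenDist T n y x < ε) ∧
      ∑' x : E, ENNReal.ofReal (Real.exp (birk T f n x)) ≤ ENNReal.ofReal (Real.exp (n * s)) := by
  obtain ⟨E, hED, hEc, hEs, hEm⟩ := exists_maxsep T hT n hε D
  refine ⟨E, hEm, ?_⟩
  have hP : IsBowenPacking T N (ε / 3) D ((fun x => (x, n)) '' E) := by
    refine ⟨hEc.image _, ?_, ?_⟩
    · rintro _ ⟨x, hx, rfl⟩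
      exact ⟨hED hx, hn⟩
    · rintro _ ⟨x, hx, rfl⟩ _ ⟨y, hy, rfl⟩ hne
      have hxy : x ≠ y := by rintro rfl; exact hne rfl
      refine Set.disjoint_left.2 fun z hz hz' => ?_
      have a1 : bowenDist T n x z ≤ ε / 3 := hz
      have a2 : bowenDist T n y z ≤ ε / 3 := hz'
      have h3 := hEs x hx y hy hxy
      have h4 := bd_triangle T n x z y
      rw [bd_comm T n z y] at h4
      linarith
  have h1 : ∑' x : E, ENNReal.ofReal (Real.exp (-(n : ℝ) * s + birk T f n x)) ≤ 1 := by
    refine le_trans ?_ ((le_iSup₂_of_le _ hP le_rfl).trans hN)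
    unfold ballSum
    rw [tsum_image (fun p : X 0 × ℕ =>
      ENNReal.ofReal (Real.exp (-(p.2 : ℝ) * s + birk T f p.2 p.1)))
      (fun a _ b _ h => (Prod.mk.inj h).1)]
  calc ∑' x : E, ENNReal.ofReal (Real.exp (birk T f n x))
      = ENNReal.ofReal (Real.exp (n * s)) *
        ∑' x : E, ENNReal.ofReal (Real.exp (-(n : ℝ) * s + birk T f n x)) := by
        rw [← ENNReal.tsum_mul_left]
        refine tsum_congr fun x => ?_
        rw [← ENNReal.ofReal_mul (Real.exp_pos _).le, ← Real.exp_add]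
        congr 2; ring
    _ ≤ ENNReal.ofReal (Real.exp (n * s)) * 1 := mul_le_mul_right h1 _
    _ = _ := mul_one _

theorem upper_pre [CompactSpace (X 0)] [CompactSpace (Y 0)]
    (T : ∀ k, X k → X (k + 1)) (hT : ∀ k, Continuous (T k))
    (R : ∀ k, Y k → Y (k + 1)) (hR : ∀ k, Continuous (R k))
    (f : ∀ k, X k → ℝ) (g : ∀ k, Y k → ℝ) {η ε ε' : ℝ} (hη : 0 < η) (hε : 0 < ε) (hε' : ε ≤ ε')
    (hf : ∀ k, ∀ x y : X k, dist x y < ε → |f k x - f k y| < η)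
    (hg : ∀ k, ∀ x y : Y k, dist x y < ε → |g k x - g k y| < η)
    (A : Set (X 0)) (B : Set (Y 0)) (s t : ℝ) (N : ℕ)
    (hA : packPre T f A s N (ε / 3) ≤ 1) (hB : packPre R g B t N (ε / 3) ≤ 1) :
    packPre (X := fun k => X k × Y k) (prodT T R) (prodF f g) (A ×ˢ B) (s + t + 3 * η) N ε' ≠ ⊤ := by
  choose E hEm hEs using fun n : {n // N ≤ n} => exists_span T hT f A s hε n.1 N n.2 hA
  choose F hFm hFs using fun n : {n // N ≤ n} => exists_span R hR g B t hε n.1 N n.2 hB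
  have hgeo : ∑' n : ℕ, ENNReal.ofReal (Real.exp (-η) ^ n) ≠ ⊤ := by
    have hs := summable_geometric_of_lt_one (Real.exp_pos (-η)).le
      (by rw [Real.exp_lt_one_iff]; linarith)
    exact hs.tsum_ofReal_ne_top
  refine ne_top_of_le_ne_top hgeo (iSup₂_le fun P hP => ?_)
  have hmap : ∀ p : P, ∃ z : (Σ n : {n // N ≤ n}, E n × F n), z.1.1 = p.1.2 ∧
      bowenDist T p.1.2 z.2.1 p.1.1.1 < ε ∧ bowenDist R p.1.2 z.2.2 p.1.1.2 < ε := by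
    rintro ⟨⟨⟨x, y⟩, n⟩, hp⟩
    obtain ⟨⟨hx, hy⟩, hn⟩ := hP.2.1 _ hp
    obtain ⟨e, he, he'⟩ := hEm ⟨n, hn⟩ x hx
    obtain ⟨e2, h2, h2'⟩ := hFm ⟨n, hn⟩ y hy
    exact ⟨⟨⟨n, hn⟩, ⟨e, he⟩, ⟨e2, h2⟩⟩, rfl, he', h2'⟩
  choose φ hφ1 hφ2 hφ3 using hmap
  have hinj : Function.Injective φ := by
    intro p q hpq
    by_contra hne
    have hne' : p.1 ≠ q.1 := fun h => hne (Subtype.ext h)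
    have hd := hP.2.2 _ p.2 _ q.2 hne'
    have key : ∀ p : P, (((φ p).2.1 : X 0), ((φ p).2.2 : Y 0)) ∈
        bowenClosedBall (X := fun k => X k × Y k) (prodT T R) p.1.2 p.1.1 ε' := by
      intro p
      refine (bd_prod_le T R p.1.2 p.1.1 _ (hε.le.trans hε')).2 ⟨?_, ?_⟩
      · rw [bd_comm]; exact ((hφ2 p).le).trans hε'
      · rw [bd_comm]; exact ((hφ3 p).le).trans hε'
    have k1 := key p
    rw [hpq] at k1
    exact Set.disjoint_left.1 hd k1 (key q)
  let w : (Σ n : {n // N ≤ n}, E n × F n) → ℝ≥0∞ := fun z =>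
    ENNReal.ofReal (Real.exp (-(z.1.1 : ℝ) * (s + t + η))) *
      (ENNReal.ofReal (Real.exp (birk T f z.1.1 z.2.1)) *
        ENNReal.ofReal (Real.exp (birk R g z.1.1 z.2.2)))
  have hstep1 : ballSum (X := fun k => X k × Y k) (prodT T R) (prodF f g) (s + t + 3 * η) P
      ≤ ∑' p : P, w (φ p) := by
    unfold ballSum
    refine ENNReal.tsum_le_tsum fun p => ?_
    simp only [w]
    rw [← ENNReal.ofReal_mul (Real.exp_pos _).le, ← ENNReal.ofReal_mul (Real.exp_pos _).le,
      ← Real.exp_add, ← Real.exp_add, birk_prod, hφ1 p]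
    refine ENNReal.ofReal_le_ofReal (Real.exp_le_exp.2 ?_)
    have b1 := birk_close T f hε hf _ _ _ (hφ2 p)
    have b2 := birk_close R g hε hg _ _ _ (hφ3 p)
    linarith
  refine hstep1.trans ((ENNReal.tsum_comp_le_tsum_of_injective hinj w).trans ?_)
  rw [ENNReal.tsum_sigma']
  refine le_trans ?_ (ENNReal.tsum_comp_le_tsum_of_injective
    (Subtype.val_injective (p := fun n => N ≤ n)) _)
  refine ENNReal.tsum_le_tsum fun n => ?_
  simp only [w]
  rw [ENNReal.tsum_mul_left, ENNReal.tsum_prod']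
  simp only [ENNReal.tsum_mul_left, ENNReal.tsum_mul_right]
  refine (mul_le_mul_right (mul_le_mul' (hEs n) (hFs n)) _).trans ?_
  rw [← ENNReal.ofReal_mul (Real.exp_pos _).le, ← ENNReal.ofReal_mul (Real.exp_pos _).le,
      ← Real.exp_add, ← Real.exp_add, ← Real.exp_nat_mul]
  refine ENNReal.ofReal_le_ofReal (Real.exp_le_exp.2 (le_of_eq ?_))
  ring

theorem exists_decomp (T : ∀ k, X k → X (k + 1)) (f : ∀ k, X k → ℝ) (Z : Set (X 0)) (s ε : ℝ)
    (h : packMeas T f Z s ε = 0) :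
    ∃ D : ℕ → Set (X 0), Z ⊆ ⋃ i, D i ∧ ∀ i, ∃ N, packPre T f (D i) s N ε ≤ 1 := by
  obtain ⟨D, hD, hDs⟩ : ∃ D : ℕ → Set (X 0), Z ⊆ ⋃ i, D i ∧
      ∑' i, packContent T f (D i) s ε < 1 := by
    have : packMeas T f Z s ε < 1 := by
      rw [h]; exact zero_lt_one
    simpa [packMeas, iInf_lt_iff] using this
  refine ⟨D, hD, fun i => ?_⟩
  obtain ⟨N, hN⟩ := iInf_lt_iff.1 ((ENNReal.le_tsum i).trans_lt hDs)
  exact ⟨N, hN.le⟩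

theorem upper_main [CompactSpace (X 0)] [CompactSpace (Y 0)]
    (T : ∀ k, X k → X (k + 1)) (hT : ∀ k, Continuous (T k))
    (R : ∀ k, Y k → Y (k + 1)) (hR : ∀ k, Continuous (R k))
    (f : ∀ k, X k → ℝ) (g : ∀ k, Y k → ℝ) {η ε ε' : ℝ} (hη : 0 < η) (hε : 0 < ε) (hε' : ε ≤ ε')
    (hf : ∀ k, ∀ x y : X k, dist x y < ε → |f k x - f k y| < η)
    (hg : ∀ k, ∀ x y : Y k, dist x y < ε → |g k x - g k y| < η)
    (Z : Set (X 0)) (W : Set (Y 0)) (s t : ℝ)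
    (hZ : packMeas T f Z s (ε / 3) = 0) (hW : packMeas R g W t (ε / 3) = 0) :
    packMeas (X := fun k => X k × Y k) (prodT T R) (prodF f g) (Z ×ˢ W) (s + t + 4 * η) ε' = 0 := by
  obtain ⟨D, hD, hDN⟩ := exists_decomp T f Z s _ hZ
  obtain ⟨G, hG, hGN⟩ := exists_decomp R g W t _ hW
  have h0 : ∀ i j, packContent (X := fun k => X k × Y k) (prodT T R) (prodF f g) (D i ×ˢ G j)
      (s + t + 4 * η) ε' = 0 := by
    intro i j
    obtain ⟨N, hN⟩ := hDN i
    obtain ⟨M, hM⟩ := hGN j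
    refine packContent_zero (X := fun k => X k × Y k) _ _ _
      (r := s + t + 3 * η) (by linarith) ε' ?_
    refine ne_top_of_le_ne_top (upper_pre T hT R hR f g hη hε hε' hf hg (D i) (G j) s t (max N M)
      ((packPre_anti _ _ _ _ _ (le_max_left _ _)).trans hN)
      ((packPre_anti _ _ _ _ _ (le_max_right _ _)).trans hM)) (iInf_le _ _)
  refine le_antisymm ((iInf₂_le (fun i => D (Nat.unpair i).1 ×ˢ G (Nat.unpair i).2) ?_).trans
    (by simp [h0])) bot_le
  rintro ⟨x, y⟩ ⟨hx, hy⟩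
  obtain ⟨i, hi⟩ := mem_iUnion.1 (hD hx)
  obtain ⟨j, hj⟩ := mem_iUnion.1 (hG hy)
  exact mem_iUnion.2 ⟨Nat.pair i j, by simpa using ⟨hi, hj⟩⟩

theorem ne_zero_of_lt_crit {M : ℝ → ℝ≥0∞} {s : ℝ} (h : (s : EReal) < crit M) : M s ≠ 0 :=
  fun h0 => absurd (sInf_le ⟨s, h0, rfl⟩ : crit M ≤ s) (not_le.2 h)

theorem exists_zero_of_crit_lt {M : ℝ → ℝ≥0∞} {a : EReal} (h : crit M < a) :
    ∃ s : ℝ, (s : EReal) < a ∧ M s = 0 := by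
  obtain ⟨_, ⟨s, hs, rfl⟩, hlt⟩ := sInf_lt_iff.1 h
  exact ⟨s, hlt, hs⟩

end aux

end NDS

/-- **product rule for the packing pressure.** For equicontinuous potentials,
`P^B(T,f,Z) + P^P(R,g,W) ≤ P^P(T×R, f∔g, Z×W) ≤ P^P(T,f,Z) + P^P(R,g,W)`, provided the sums
are not of the form `(+∞)+(−∞)`. -/
theorem packing_pressure_product_rule {X Y : ℕ → Type*} [∀ k, MetricSpace (X k)]
    [∀ k, CompactSpace (X k)] [∀ k, MetricSpace (Y k)] [∀ k, CompactSpace (Y k)]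
    (T : ∀ k, X k → X (k + 1)) (hT : ∀ k, Continuous (T k))
    (R : ∀ k, Y k → Y (k + 1)) (hR : ∀ k, Continuous (R k))
    (f : ∀ k, X k → ℝ) (hf : ∀ k, Continuous (f k)) (hfe : NDS.EquicontPotential f)
    (g : ∀ k, Y k → ℝ) (hg : ∀ k, Continuous (g k)) (hge : NDS.EquicontPotential g)
    (Z : Set (X 0)) (W : Set (Y 0))
    (h₁ : NDS.AddCompat (NDS.PB T f Z) (NDS.PP R g W))
    (h₂ : NDS.AddCompat (NDS.PP T f Z) (NDS.PP R g W)) :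
    NDS.PB T f Z + NDS.PP R g W ≤
      NDS.PP (X := fun k => X k × Y k) (fun k p => (T k p.1, R k p.2))
        (fun k p => f k p.1 + g k p.2) (Z ×ˢ W) ∧
    NDS.PP (X := fun k => X k × Y k) (fun k p => (T k p.1, R k p.2))
        (fun k p => f k p.1 + g k p.2) (Z ×ˢ W) ≤
      NDS.PP T f Z + NDS.PP R g W := by
  constructor
  · refine EReal.add_le_of_forall_lt fun a ha b hb => ?_
    obtain ⟨ε₁, h1, ha⟩ : ∃ ε₁ : ℝ, 0 < ε₁ ∧ a < NDS.PBe T f Z ε₁ := by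
      simpa [NDS.PB, lt_iSup_iff] using ha
    obtain ⟨ε₂, h2, hb⟩ : ∃ ε₂ : ℝ, 0 < ε₂ ∧ b < NDS.PPe R g W ε₂ := by
      simpa [NDS.PP, lt_iSup_iff] using hb
    induction a with
    | bot => simp
    | top => exact absurd ha not_top_lt
    | coe s =>
    induction b with
    | bot => simp
    | top => exact absurd hb not_top_lt
    | coe t =>
    have hε : 0 < min (ε₁ / 3) ε₂ := lt_min (by linarith) h2
    refine le_iSup₂_of_le (min (ε₁ / 3) ε₂) hε ?_
    refine le_sInf ?_
    rintro _ ⟨r, hr, rfl⟩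
    rw [← EReal.coe_add, EReal.coe_le_coe_iff]
    by_contra! hlt
    exact NDS.lower_main T hT R f g Z W s t r h1 hε
      ((min_le_left _ _).trans_lt (by linarith)) (min_le_right _ _)
      (NDS.ne_zero_of_lt_crit (M := fun s => NDS.bowenMeas T f Z s ε₁) ha)
      (NDS.ne_zero_of_lt_crit (M := fun s => NDS.packMeas R g W s ε₂) hb) hlt hr
  · refine EReal.le_add_of_forall_gt ?_ ?_ fun a ha b hb => ?_
    · by_contra! h; exact h₂.2 h
    · by_contra! h; exact h₂.1 h
    refine iSup₂_le fun ε' hε' => ?_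
    have hpos : ∀ η : ℝ, 0 < η → ∃ s t : ℝ, (s : EReal) < a ∧ (t : EReal) < b ∧
        NDS.PPe (X := fun k => X k × Y k) (fun k p => (T k p.1, R k p.2))
          (fun k p => f k p.1 + g k p.2) (Z ×ˢ W) ε' ≤ ((s + t + 4 * η : ℝ) : EReal) := by
      intro η hη
      obtain ⟨δ₁, hδ₁, hf1⟩ := hfe η hη
      obtain ⟨δ₂, hδ₂, hg1⟩ := hge η hη
      have hε : 0 < min ε' (min δ₁ δ₂) := lt_min hε' (lt_min hδ₁ hδ₂)
      set ε := min ε' (min δ₁ δ₂) with hεd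
      have e1 : ε ≤ δ₁ := (min_le_right _ _).trans (min_le_left _ _)
      have e2 : ε ≤ δ₂ := (min_le_right _ _).trans (min_le_right _ _)
      obtain ⟨s, hs, hs0⟩ := NDS.exists_zero_of_crit_lt
        (((le_iSup₂_of_le (ε / 3) (by linarith) le_rfl :
          NDS.PPe T f Z (ε / 3) ≤ NDS.PP T f Z)).trans_lt ha)
      obtain ⟨t, ht, ht0⟩ := NDS.exists_zero_of_crit_lt
        (((le_iSup₂_of_le (ε / 3) (by linarith) le_rfl :
          NDS.PPe R g W (ε / 3) ≤ NDS.PP R g W)).trans_lt hb)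
      refine ⟨s, t, hs, ht, sInf_le ⟨_, ?_, rfl⟩⟩
      exact NDS.upper_main T hT R hR f g hη hε (min_le_left _ _)
        (fun k x y h => hf1 k x y (h.trans_le e1)) (fun k x y h => hg1 k x y (h.trans_le e2))
        Z W s t hs0 ht0
    obtain ⟨s0, t0, hs0, ht0, -⟩ := hpos 1 one_pos
    have hab : ∀ η : ℝ, 0 < η → NDS.PPe (X := fun k => X k × Y k) (fun k p => (T k p.1, R k p.2))
          (fun k p => f k p.1 + g k p.2) (Z ×ˢ W) ε' ≤ a + b + ((4 * η : ℝ) : EReal) := by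
      intro η hη
      obtain ⟨s, t, hs, ht, h⟩ := hpos η hη
      refine h.trans ?_
      rw [EReal.coe_add, EReal.coe_add]
      exact add_le_add (add_le_add hs.le ht.le) le_rfl
    induction a with
    | bot => exact absurd hs0 not_lt_bot
    | top =>
      rw [EReal.top_add_of_ne_bot (ne_bot_of_gt ht0)]; exact le_top
    | coe s =>
    induction b with
    | bot => exact absurd ht0 not_lt_bot
    | top => rw [EReal.coe_add_top]; exact le_top
    | coe t =>
    refine EReal.le_of_forall_lt_iff_le.1 fun z hz => ?_
    rw [← EReal.coe_add, EReal.coe_lt_coe_iff] at hz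
    refine (hab ((z - (s + t)) / 4) (by linarith)).trans ?_
    rw [← EReal.coe_add, ← EReal.coe_add, EReal.coe_le_coe_iff]
    linarith
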